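/- arXiv:1909.13824 — 7 statements merged into one kernel-verified Lean document; each statement's English description precedes it below -/
import Mathlib

section
/- Let 𝔤 be a Lie algebra over ℝ, let γ ∈ ℝ satisfy γ² = 1, and let R be a linear endomorphism of 𝔤 satisfying R³ = γ • R and the modified Yang–Baxter identity ⁅R x, R y⁆ − R (⁅R x, y⁆ + ⁅x, R y⁆) = −γ • ⁅x, y⁆ for all x, y ∈ 𝔤. Then for every θ ∈ ℝ, the endomorphism R̃ := R + θ • (id − γ • R²) satisfies the same modified Yang–Baxter identity: ⁅R̃ x, R̃ y⁆ − R̃ (⁅R̃ x, y⁆ + ⁅x, R̃ y⁆) = −γ • ⁅x, y⁆ for all x, y ∈ 𝔤. -/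
/-- If `R³ = γ • R` with `γ² = 1` and `R` satisfies the modified Yang–Baxter
identity `⁅Rx,Ry⁆ − R(⁅Rx,y⁆ + ⁅x,Ry⁆) = −γ • ⁅x,y⁆`, then for any `θ ∈ ℝ` the
endomorphism `R̃ := R + θ • (id − γ • R²)` satisfies the same identity. -/
theorem stmt_5 {𝔤 : Type*} [LieRing 𝔤] [LieAlgebra ℝ 𝔤]
    (γ : ℝ) (hγ : γ ^ 2 = 1) (R : 𝔤 →ₗ[ℝ] 𝔤)
    (hR3 : R ∘ₗ R ∘ₗ R = γ • R)
    (hYB : ∀ x y : 𝔤, ⁅R x, R y⁆ - R (⁅R x, y⁆ + ⁅x, R y⁆) = -γ • ⁅x, y⁆)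
    (θ : ℝ) :
    ∀ x y : 𝔤,
      ⁅(R + θ • ((LinearMap.id : 𝔤 →ₗ[ℝ] 𝔤) - γ • (R ∘ₗ R))) x,
        (R + θ • ((LinearMap.id : 𝔤 →ₗ[ℝ] 𝔤) - γ • (R ∘ₗ R))) y⁆ -
      (R + θ • ((LinearMap.id : 𝔤 →ₗ[ℝ] 𝔤) - γ • (R ∘ₗ R)))
        (⁅(R + θ • ((LinearMap.id : 𝔤 →ₗ[ℝ] 𝔤) - γ • (R ∘ₗ R))) x, y⁆ +
          ⁅x, (R + θ • ((LinearMap.id : 𝔤 →ₗ[ℝ] 𝔤) - γ • (R ∘ₗ R))) y⁆) =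
      -γ • ⁅x, y⁆ := by
  have hγγ : γ * γ = 1 := by rw [← sq, hγ]
  have hγs (v : 𝔤) : γ • γ • v = v := by rw [smul_smul, hγγ, one_smul]
  have hR (v : 𝔤) : R (R (R v)) = γ • R v := LinearMap.congr_fun hR3 v
  set P : 𝔤 →ₗ[ℝ] 𝔤 := LinearMap.id - γ • (R ∘ₗ R)
  have hP (v : 𝔤) : P v = v - γ • R (R v) := rfl
  have hRP (v : 𝔤) : R (P v) = 0 := by
    rw [hP, map_sub, map_smul, hR, hγs, sub_self]
  have hPR (v : 𝔤) : P (R v) = 0 := by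
    rw [hP, hR, hγs, sub_self]
  have hRR (v : 𝔤) : R (R v) = γ • (v - P v) := by
    rw [hP, sub_sub_cancel, hγs]
  have ker_bracket (k z : 𝔤) (hk : R k = 0) : ⁅k, z⁆ = γ • R ⁅k, R z⁆ := by
    have h := hYB k z
    simp only [hk, zero_lie, zero_add, zero_sub, neg_smul, neg_inj] at h
    rw [h, hγs]
  have ker_abelian (k l : 𝔤) (hk : R k = 0) (hl : R l = 0) : ⁅k, l⁆ = 0 := by
    rw [ker_bracket k l hk, hl, lie_zero, map_zero, smul_zero]
  have map_ker_bracket (k w : 𝔤) (hk : R k = 0) : R ⁅k, w⁆ = ⁅k, R w⁆ := by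
    rw [ker_bracket k (R w) hk, hRR, lie_smul, lie_sub, ker_abelian k (P w) hk (hRP w),
      sub_zero, map_smul, hγs]
  have proj_ker_bracket (k w : 𝔤) (hk : R k = 0) : P ⁅k, w⁆ = 0 := by
    rw [ker_bracket k w hk, map_smul, hPR, smul_zero]
  have proj_derived (x y : 𝔤) : P ⁅R x, y⁆ + P ⁅x, R y⁆ = 0 := by
    have h := congrArg P (hYB (R x) y)
    rw [map_sub, hPR, sub_zero, hRR, smul_lie, sub_lie, map_smul, map_smul, map_sub,
      proj_ker_bracket (P x) (R y) (hRP x), sub_zero] at h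
    have h' := congrArg (γ • ·) h
    simp only [neg_smul, smul_neg, hγs] at h'
    rw [h', add_neg_cancel]
  intro x y
  have bracket_ker (v k : 𝔤) : ⁅v, k⁆ = -⁅k, v⁆ := (lie_skew v k).symm
  have e₁ : R ⁅P x, y⁆ = ⁅P x, R y⁆ := map_ker_bracket _ _ (hRP x)
  have e₂ : R ⁅x, P y⁆ = ⁅R x, P y⁆ := by
    rw [bracket_ker, map_neg, map_ker_bracket _ _ (hRP y), lie_skew]
  have e₃ : P ⁅P x, y⁆ = 0 := proj_ker_bracket _ _ (hRP x)
  have e₄ : P ⁅x, P y⁆ = 0 := by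
    rw [bracket_ker, map_neg, proj_ker_bracket _ _ (hRP y), neg_zero]
  have e₅ : ⁅P x, P y⁆ = 0 := ker_abelian _ _ (hRP x) (hRP y)
  have e₆ : P ⁅x, R y⁆ = -P ⁅R x, y⁆ := eq_neg_of_add_eq_zero_right (proj_derived x y)
  rw [← hYB x y]
  simp only [LinearMap.add_apply, LinearMap.smul_apply, add_lie, lie_add, smul_lie, lie_smul,
    map_add, map_smul, e₁, e₂, e₃, e₄, e₅, e₆]
  module
end

section
/- Let 𝔤 be a Lie algebra over a field K, let c ∈ K, and let R be a linear endomorphism of 𝔤 satisfying the modified classical Yang–Baxter equation with parameter c, i.e. ⁅R x, R y⁆ − R (⁅R x, y⁆ + ⁅x, R y⁆) = −c² • ⁅x, y⁆ for all x, y ∈ 𝔤. Then for all x, y ∈ 𝔤, setting z := ⁅R x, y⁆ + ⁅x, R y⁆, one has ⁅R x − c • x, R y − c • y⁆ = R z − c • z and ⁅R x + c • x, R y + c • y⁆ = R z + c • z. Consequently the subset {(R x − c • x, R x + c • x) : x ∈ 𝔤} of 𝔤 × 𝔤 is closed under the componentwise Lie bracket. -/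
/-- If `R` solves the modified classical Yang–Baxter equation with parameter `c`, then `R + c`
intertwines the bracket `⁅R x, y⁆ + ⁅x, R y⁆` with the original one. -/
theorem lie_add_smul_of_modifiedYangBaxter {K 𝔤 : Type*} [Field K] [LieRing 𝔤] [LieAlgebra K 𝔤]
    (c : K) (R : 𝔤 →ₗ[K] 𝔤)
    (hR : ∀ x y : 𝔤, ⁅R x, R y⁆ - R (⁅R x, y⁆ + ⁅x, R y⁆) = -(c ^ 2) • ⁅x, y⁆) (x y : 𝔤) :
    ⁅R x + c • x, R y + c • y⁆ =
      R (⁅R x, y⁆ + ⁅x, R y⁆) + c • (⁅R x, y⁆ + ⁅x, R y⁆) := by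
  have h := sub_eq_iff_eq_add.mp (hR x y)
  simp only [add_lie, lie_add, smul_lie, lie_smul] at h ⊢
  rw [h]
  module


/-- For a solution `R` of the modified classical Yang–Baxter equation with
parameter `c`, setting `z := ⁅Rx,y⁆ + ⁅x,Ry⁆` one has
`⁅Rx − c•x, Ry − c•y⁆ = Rz − c•z` and `⁅Rx + c•x, Ry + c•y⁆ = Rz + c•z`; consequently
`{(Rx − c•x, Rx + c•x) : x ∈ 𝔤}` is closed under the componentwise Lie bracket. -/
theorem stmt_6 {K 𝔤 : Type*} [Field K] [LieRing 𝔤] [LieAlgebra K 𝔤]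
    (c : K) (R : 𝔤 →ₗ[K] 𝔤)
    (hR : ∀ x y : 𝔤, ⁅R x, R y⁆ - R (⁅R x, y⁆ + ⁅x, R y⁆) = -(c ^ 2) • ⁅x, y⁆) :
    (∀ x y : 𝔤,
      ⁅R x - c • x, R y - c • y⁆ =
        R (⁅R x, y⁆ + ⁅x, R y⁆) - c • (⁅R x, y⁆ + ⁅x, R y⁆) ∧
      ⁅R x + c • x, R y + c • y⁆ =
        R (⁅R x, y⁆ + ⁅x, R y⁆) + c • (⁅R x, y⁆ + ⁅x, R y⁆)) ∧
    ∀ p q : 𝔤 × 𝔤,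
      p ∈ Set.range (fun x : 𝔤 => (R x - c • x, R x + c • x)) →
      q ∈ Set.range (fun x : 𝔤 => (R x - c • x, R x + c • x)) →
      (⁅p.1, q.1⁆, ⁅p.2, q.2⁆) ∈
        Set.range (fun x : 𝔤 => (R x - c • x, R x + c • x)) := by
  have hadd := lie_add_smul_of_modifiedYangBaxter c R hR
  have hsub : ∀ x y : 𝔤, ⁅R x - c • x, R y - c • y⁆ =
      R (⁅R x, y⁆ + ⁅x, R y⁆) - c • (⁅R x, y⁆ + ⁅x, R y⁆) := by
    intro x y
    simpa only [neg_smul, ← sub_eq_add_neg] using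
      lie_add_smul_of_modifiedYangBaxter (-c) R (by simpa only [neg_sq] using hR) x y
  refine ⟨fun x y => ⟨hsub x y, hadd x y⟩, ?_⟩
  rintro _ _ ⟨x, rfl⟩ ⟨y, rfl⟩
  exact ⟨⁅R x, y⁆ + ⁅x, R y⁆, Prod.ext (hsub x y).symm (hadd x y).symm⟩
end

section
/- Let 𝔤 be a Lie algebra over ℝ and let R be a linear endomorphism of 𝔤 satisfying ⁅R x, R y⁆ − R (⁅R x, y⁆ + ⁅x, R y⁆) = ⁅x, y⁆ for all x, y ∈ 𝔤 (the modified classical Yang–Baxter equation with parameter c = i). Then in the complexified Lie algebra ℂ ⊗[ℝ] 𝔤, for all x, y ∈ 𝔤 one has ⁅1 ⊗ (R x) − i ⊗ x, 1 ⊗ (R y) − i ⊗ y⁆ = 1 ⊗ (R z) − i ⊗ z, where z := ⁅R x, y⁆ + ⁅x, R y⁆. Consequently the real subspace {1 ⊗ (R x) − i ⊗ x : x ∈ 𝔤} of ℂ ⊗[ℝ] 𝔤 is closed under the Lie bracket. -/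
open TensorProduct

/-- For a solution `R` of the modified classical Yang–Baxter equation with
`c = i`, in the complexified Lie algebra `ℂ ⊗[ℝ] 𝔤` one has
`⁅1 ⊗ Rx − i ⊗ x, 1 ⊗ Ry − i ⊗ y⁆ = 1 ⊗ Rz − i ⊗ z` with `z = ⁅Rx,y⁆ + ⁅x,Ry⁆`;
consequently `{1 ⊗ Rx − i ⊗ x : x ∈ 𝔤}` is closed under the Lie bracket. -/
theorem stmt_9 {𝔤 : Type*} [LieRing 𝔤] [LieAlgebra ℝ 𝔤]
    (R : 𝔤 →ₗ[ℝ] 𝔤)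
    (hR : ∀ x y : 𝔤, ⁅R x, R y⁆ - R (⁅R x, y⁆ + ⁅x, R y⁆) = ⁅x, y⁆) :
    (∀ x y : 𝔤,
      ⁅(1 : ℂ) ⊗ₜ[ℝ] (R x) - Complex.I ⊗ₜ[ℝ] x,
        (1 : ℂ) ⊗ₜ[ℝ] (R y) - Complex.I ⊗ₜ[ℝ] y⁆ =
      (1 : ℂ) ⊗ₜ[ℝ] (R (⁅R x, y⁆ + ⁅x, R y⁆)) -
        Complex.I ⊗ₜ[ℝ] (⁅R x, y⁆ + ⁅x, R y⁆)) ∧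
    ∀ a b : ℂ ⊗[ℝ] 𝔤,
      a ∈ Set.range (fun x : 𝔤 => (1 : ℂ) ⊗ₜ[ℝ] (R x) - Complex.I ⊗ₜ[ℝ] x) →
      b ∈ Set.range (fun x : 𝔤 => (1 : ℂ) ⊗ₜ[ℝ] (R x) - Complex.I ⊗ₜ[ℝ] x) →
      ⁅a, b⁆ ∈ Set.range (fun x : 𝔤 => (1 : ℂ) ⊗ₜ[ℝ] (R x) - Complex.I ⊗ₜ[ℝ] x) := by
  have key : ∀ x y : 𝔤,
      ⁅(1 : ℂ) ⊗ₜ[ℝ] (R x) - Complex.I ⊗ₜ[ℝ] x,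
        (1 : ℂ) ⊗ₜ[ℝ] (R y) - Complex.I ⊗ₜ[ℝ] y⁆ =
      (1 : ℂ) ⊗ₜ[ℝ] (R (⁅R x, y⁆ + ⁅x, R y⁆)) -
        Complex.I ⊗ₜ[ℝ] (⁅R x, y⁆ + ⁅x, R y⁆) := by
    intro x y
    have hz : R (⁅R x, y⁆ + ⁅x, R y⁆) = ⁅R x, R y⁆ - ⁅x, y⁆ := by
      rw [← hR x y, sub_sub_cancel]
    rw [hz]
    simp only [sub_lie, lie_sub, LieAlgebra.ExtendScalars.bracket_tmul, one_mul, mul_one,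
      Complex.I_mul_I, TensorProduct.neg_tmul, TensorProduct.tmul_sub, TensorProduct.tmul_add]
    abel
  refine ⟨key, ?_⟩
  rintro _ _ ⟨x, rfl⟩ ⟨y, rfl⟩
  exact ⟨⁅R x, y⁆ + ⁅x, R y⁆, (key x y).symm⟩
end

section
/- Let 𝔤 be a Lie algebra over ℝ and let R be a linear endomorphism of 𝔤 satisfying the classical Yang–Baxter equation ⁅R x, R y⁆ = R (⁅R x, y⁆ + ⁅x, R y⁆) for all x, y ∈ 𝔤. In the Lie algebra (DualNumber ℝ) ⊗[ℝ] 𝔤 obtained by base change (where ε denotes the dual number with ε² = 0), for all x, y ∈ 𝔤 one has ⁅ε ⊗ x − 1 ⊗ (R x), ε ⊗ y − 1 ⊗ (R y)⁆ = ε ⊗ z − 1 ⊗ (R z), where z := −(⁅R x, y⁆ + ⁅x, R y⁆). Consequently the real subspace {ε ⊗ x − 1 ⊗ (R x) : x ∈ 𝔤} is closed under the Lie bracket. -/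
open TensorProduct DualNumber

/-- If `R` satisfies the classical Yang–Baxter equation and `e ^ 2 = 0`, the elements
`e ⊗ x - 1 ⊗ R x` of a base change are closed under the bracket. -/
theorem lie_tmul_sub_one_tmul_of_yangBaxter {S A L : Type*} [CommRing S] [CommRing A]
    [Algebra S A] [LieRing L] [LieAlgebra S L] (R : L →ₗ[S] L)
    (hR : ∀ x y : L, ⁅R x, R y⁆ = R (⁅R x, y⁆ + ⁅x, R y⁆))
    {e : A} (he : e * e = 0) (x y : L) :
    ⁅e ⊗ₜ[S] x - (1 : A) ⊗ₜ[S] R x, e ⊗ₜ[S] y - (1 : A) ⊗ₜ[S] R y⁆ =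
      e ⊗ₜ[S] (-(⁅R x, y⁆ + ⁅x, R y⁆)) - (1 : A) ⊗ₜ[S] R (-(⁅R x, y⁆ + ⁅x, R y⁆)) := by
  have h : ⁅e ⊗ₜ[S] x - (1 : A) ⊗ₜ[S] R x, e ⊗ₜ[S] y - (1 : A) ⊗ₜ[S] R y⁆ =
      ⁅e ⊗ₜ[S] x, e ⊗ₜ[S] y⁆ - ⁅(1 : A) ⊗ₜ[S] R x, e ⊗ₜ[S] y⁆ -
        (⁅e ⊗ₜ[S] x, (1 : A) ⊗ₜ[S] R y⁆ - ⁅(1 : A) ⊗ₜ[S] R x, (1 : A) ⊗ₜ[S] R y⁆) :=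
    (lie_sub _ _ _).trans (congrArg₂ _ (sub_lie _ _ _) (sub_lie _ _ _))
  rw [h]
  simp only [LieAlgebra.ExtendScalars.bracket_tmul, he, zero_tmul, one_mul, mul_one, map_neg,
    ← hR, tmul_neg, tmul_add]
  abel

/-- For a solution `R` of the classical Yang–Baxter equation, in the Lie
algebra `(DualNumber ℝ) ⊗[ℝ] 𝔤` (realizing `𝔤 ⋉ 𝔤_ab`) one has
`⁅ε ⊗ x − 1 ⊗ Rx, ε ⊗ y − 1 ⊗ Ry⁆ = ε ⊗ z − 1 ⊗ Rz` with `z = −(⁅Rx,y⁆ + ⁅x,Ry⁆)`;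
consequently `{ε ⊗ x − 1 ⊗ Rx : x ∈ 𝔤}` is closed under the Lie bracket. -/
theorem stmt_14 {𝔤 : Type*} [LieRing 𝔤] [LieAlgebra ℝ 𝔤]
    (R : 𝔤 →ₗ[ℝ] 𝔤)
    (hR : ∀ x y : 𝔤, ⁅R x, R y⁆ = R (⁅R x, y⁆ + ⁅x, R y⁆)) :
    (∀ x y : 𝔤,
      ⁅(ε : DualNumber ℝ) ⊗ₜ[ℝ] x - (1 : DualNumber ℝ) ⊗ₜ[ℝ] (R x),
        (ε : DualNumber ℝ) ⊗ₜ[ℝ] y - (1 : DualNumber ℝ) ⊗ₜ[ℝ] (R y)⁆ =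
      (ε : DualNumber ℝ) ⊗ₜ[ℝ] (-(⁅R x, y⁆ + ⁅x, R y⁆)) -
        (1 : DualNumber ℝ) ⊗ₜ[ℝ] (R (-(⁅R x, y⁆ + ⁅x, R y⁆)))) ∧
    ∀ a b : (DualNumber ℝ) ⊗[ℝ] 𝔤,
      a ∈ Set.range (fun x : 𝔤 =>
        (ε : DualNumber ℝ) ⊗ₜ[ℝ] x - (1 : DualNumber ℝ) ⊗ₜ[ℝ] (R x)) →
      b ∈ Set.range (fun x : 𝔤 =>
        (ε : DualNumber ℝ) ⊗ₜ[ℝ] x - (1 : DualNumber ℝ) ⊗ₜ[ℝ] (R x)) →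
      ⁅a, b⁆ ∈ Set.range (fun x : 𝔤 =>
        (ε : DualNumber ℝ) ⊗ₜ[ℝ] x - (1 : DualNumber ℝ) ⊗ₜ[ℝ] (R x)) := by
  have key := lie_tmul_sub_one_tmul_of_yangBaxter R hR (DualNumber.eps_mul_eps (R := ℝ))
  refine ⟨key, ?_⟩
  rintro _ _ ⟨x, rfl⟩ ⟨y, rfl⟩
  exact ⟨_, (key x y).symm⟩
end

section
/- Let 𝔤 be a real vector space with a symmetric bilinear form B, and let R be a linear endomorphism of 𝔤 skew-symmetric with respect to B (B(R x, y) = −B(x, R y)) and satisfying R³ = R. Set π₀ := id − R² and, for θ ∈ ℝ, set R̃ := R + θ • π₀. Then for all x, y ∈ 𝔤: B(R̃ x − x, R̃ y − y) = (θ − 1)² • B(x, π₀ y) and B(R̃ x + x, R̃ y + y) = (θ + 1)² • B(x, π₀ y). -/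
/-- For `B` symmetric, `R` skew-symmetric with `R³ = R`, `π₀ := id − R²`
and `R̃ := R + θ • π₀`, one has `B(R̃x − x, R̃y − y) = (θ−1)² B(x, π₀ y)` and
`B(R̃x + x, R̃y + y) = (θ+1)² B(x, π₀ y)`. -/
theorem stmt_15 {𝔤 : Type*} [AddCommGroup 𝔤] [Module ℝ 𝔤]
    (B : 𝔤 →ₗ[ℝ] 𝔤 →ₗ[ℝ] ℝ) (hsymm : ∀ x y : 𝔤, B x y = B y x)
    (R : 𝔤 →ₗ[ℝ] 𝔤) (hskew : ∀ x y : 𝔤, B (R x) y = -B x (R y))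
    (hR3 : R ∘ₗ R ∘ₗ R = R) (θ : ℝ) :
    ∀ x y : 𝔤,
      B ((R + θ • ((LinearMap.id : 𝔤 →ₗ[ℝ] 𝔤) - R ∘ₗ R)) x - x)
          ((R + θ • ((LinearMap.id : 𝔤 →ₗ[ℝ] 𝔤) - R ∘ₗ R)) y - y) =
        (θ - 1) ^ 2 • B x (((LinearMap.id : 𝔤 →ₗ[ℝ] 𝔤) - R ∘ₗ R) y) ∧
      B ((R + θ • ((LinearMap.id : 𝔤 →ₗ[ℝ] 𝔤) - R ∘ₗ R)) x + x)
          ((R + θ • ((LinearMap.id : 𝔤 →ₗ[ℝ] 𝔤) - R ∘ₗ R)) y + y) =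
        (θ + 1) ^ 2 • B x (((LinearMap.id : 𝔤 →ₗ[ℝ] 𝔤) - R ∘ₗ R) y) := by
  have hR (z : 𝔤) : R (R (R z)) = R z := LinearMap.congr_fun hR3 z
  intro x y
  constructor <;>
  · simp only [LinearMap.add_apply, LinearMap.sub_apply, LinearMap.smul_apply,
      LinearMap.id_apply, LinearMap.comp_apply, map_add, map_sub, map_smul, hskew, hR,
      smul_eq_mul]
    ring
end

section
/- Let 𝔤 be a real vector space with a symmetric bilinear form B, let R be a linear endomorphism of 𝔤 skew-symmetric with respect to B and satisfying R³ = R, set π₀ := id − R² and R̃ := R + θ • π₀ for some θ ∈ ℝ. Let r₊, r₋ ∈ ℝ satisfy (θ − 1)² r₊ + (θ + 1)² r₋ = 0. Then for all x, y ∈ 𝔤, r₊ • B(R̃ x − x, R̃ y − y) + r₋ • B(R̃ x + x, R̃ y + y) = 0; that is, the subspace {(R̃ x − x, R̃ x + x) : x ∈ 𝔤} of 𝔤 × 𝔤 is isotropic for the bilinear form ((a,b),(a',b')) ↦ r₊ B(a,a') + r₋ B(b,b'). -/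
/-- With `B`, `R`, `π₀ := id − R²`, `R̃ := R + θ • π₀` as in Statement 15
and `(θ−1)² r₊ + (θ+1)² r₋ = 0`, the subspace `{(R̃x − x, R̃x + x)}` is isotropic for
`((a,b),(a',b')) ↦ r₊ B(a,a') + r₋ B(b,b')`. -/
theorem stmt_16 {𝔤 : Type*} [AddCommGroup 𝔤] [Module ℝ 𝔤]
    (B : 𝔤 →ₗ[ℝ] 𝔤 →ₗ[ℝ] ℝ) (hsymm : ∀ x y : 𝔤, B x y = B y x)
    (R : 𝔤 →ₗ[ℝ] 𝔤) (hskew : ∀ x y : 𝔤, B (R x) y = -B x (R y))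
    (hR3 : R ∘ₗ R ∘ₗ R = R) (θ rp rm : ℝ)
    (hr : (θ - 1) ^ 2 * rp + (θ + 1) ^ 2 * rm = 0) :
    ∀ x y : 𝔤,
      rp * B ((R + θ • ((LinearMap.id : 𝔤 →ₗ[ℝ] 𝔤) - R ∘ₗ R)) x - x)
          ((R + θ • ((LinearMap.id : 𝔤 →ₗ[ℝ] 𝔤) - R ∘ₗ R)) y - y) +
      rm * B ((R + θ • ((LinearMap.id : 𝔤 →ₗ[ℝ] 𝔤) - R ∘ₗ R)) x + x)
          ((R + θ • ((LinearMap.id : 𝔤 →ₗ[ℝ] 𝔤) - R ∘ₗ R)) y + y) = 0 := by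
  intro x y
  have hR (z : 𝔤) : R (R (R z)) = R z := LinearMap.congr_fun hR3 z
  simp only [LinearMap.add_apply, LinearMap.smul_apply, LinearMap.sub_apply, LinearMap.id_apply,
    LinearMap.comp_apply, map_add, map_sub, map_smul, smul_eq_mul, hskew, hR]
  linear_combination (B x y - B x (R (R y))) * hr
end

section
/- Let M be a module over a field K, let ε ∈ K satisfy ε² = 1, and let R be a linear endomorphism of M with R³ = ε • R. Let a, b ∈ K with a ≠ 0 and a² − ε b² ≠ 0. Then the endomorphism a • id + b • R is invertible, with inverse a⁻¹ • id − (b / (a² − ε b²)) • R + (b² / (a (a² − ε b²))) • R²; that is, the composite of a • id + b • R with this endomorphism, in either order, is the identity. -/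
/-- If `R³ = ε • R` with `ε² = 1`, `a ≠ 0` and `a² − ε b² ≠ 0`, then
`a • id + b • R` is invertible with inverse
`a⁻¹ • id − (b / (a² − ε b²)) • R + (b² / (a (a² − ε b²))) • R²`. -/
theorem stmt_17 {K M : Type*} [Field K] [AddCommGroup M] [Module K M]
    (ε : K) (hε : ε ^ 2 = 1) (R : M →ₗ[K] M)
    (hR : R ∘ₗ R ∘ₗ R = ε • R)
    (a b : K) (ha : a ≠ 0) (hab : a ^ 2 - ε * b ^ 2 ≠ 0) :
    (a • (LinearMap.id : M →ₗ[K] M) + b • R) ∘ₗ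
      (a⁻¹ • (LinearMap.id : M →ₗ[K] M) - (b / (a ^ 2 - ε * b ^ 2)) • R +
        (b ^ 2 / (a * (a ^ 2 - ε * b ^ 2))) • (R ∘ₗ R)) = LinearMap.id ∧
    (a⁻¹ • (LinearMap.id : M →ₗ[K] M) - (b / (a ^ 2 - ε * b ^ 2)) • R +
        (b ^ 2 / (a * (a ^ 2 - ε * b ^ 2))) • (R ∘ₗ R)) ∘ₗ
      (a • (LinearMap.id : M →ₗ[K] M) + b • R) = LinearMap.id := by
  have hR' (x : M) : R (R (R x)) = ε • R x := LinearMap.congr_fun hR x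
  generalize hd : a ^ 2 - ε * b ^ 2 = d at hab ⊢
  constructor <;> ext x <;>
    simp only [LinearMap.comp_apply, LinearMap.add_apply, LinearMap.sub_apply,
      LinearMap.smul_apply, LinearMap.id_apply, map_add, map_sub, map_smul, hR'] <;>
    match_scalars <;> field_simp <;> subst hd <;> ring
end
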